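/- arXiv:2110.06984 — 3 statements merged into one kernel-verified Lean document; each statement's English description precedes it below -/
import Mathlib

section
/- The supremum over all nonzero symmetric n × n real matrices A of the ratio ‖𝒯_n(A)‖_□ / ‖A‖_□ tends to infinity as n → ∞. Equivalently, for every c > 0 there exists n and a symmetric n × n real matrix A with ‖A‖_□ ≠ 0 and ‖𝒯_n(A)‖_□ > c·‖A‖_□. -/
open MeasureTheory Filter

/-- Cut norm of an `n × n` real matrix:
`(1/n²) · sup_{S,T ⊆ [n]} |∑_{i∈S, j∈T} a_ij|`. -/
noncomputable def cutNorm {n : ℕ} (A : Matrix (Fin n) (Fin n) ℝ) : ℝ :=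
  (1 / (n : ℝ) ^ 2) * sSup {r : ℝ | ∃ S T : Finset (Fin n), r = |∑ i ∈ S, ∑ j ∈ T, A i j|}
/-- Triangular cut `𝒯_n(A) = A ∘ T_n`, where `(T_n)_{ij} = 1` if `i ≥ j` and `0` if `i < j`:
entries with `i < j` are set to zero. -/
def tri {n : ℕ} (A : Matrix (Fin n) (Fin n) ℝ) : Matrix (Fin n) (Fin n) ℝ :=
  fun i j => if j ≤ i then A i j else 0

theorem abs_sum_le_cutNorm {n : ℕ} (hn : 0 < n) (A : Matrix (Fin n) (Fin n) ℝ)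
    (S T : Finset (Fin n)) :
    |∑ i ∈ S, ∑ j ∈ T, A i j| ≤ (n : ℝ) ^ 2 * cutNorm A := by
  have hfin : {r : ℝ | ∃ S T : Finset (Fin n), r = |∑ i ∈ S, ∑ j ∈ T, A i j|}.Finite := by
    refine (Set.finite_range fun p : Finset (Fin n) × Finset (Fin n) =>
      |∑ i ∈ p.1, ∑ j ∈ p.2, A i j|).subset ?_
    rintro r ⟨S, T, rfl⟩
    exact ⟨(S, T), rfl⟩
  have hn' : (n : ℝ) ≠ 0 := by positivity
  rw [cutNorm, ← mul_assoc, mul_one_div_cancel (pow_ne_zero 2 hn'), one_mul]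
  exact le_csSup hfin.bddAbove ⟨S, T, rfl⟩

theorem cutNorm_le {n : ℕ} (A : Matrix (Fin n) (Fin n) ℝ) {C : ℝ}
    (h : ∀ S T : Finset (Fin n), |∑ i ∈ S, ∑ j ∈ T, A i j| ≤ C) :
    cutNorm A ≤ C / (n : ℝ) ^ 2 := by
  rw [cutNorm, div_eq_mul_one_div C, mul_comm C]
  refine mul_le_mul_of_nonneg_left (csSup_le ⟨_, ∅, ∅, rfl⟩ ?_) (by positivity)
  rintro r ⟨S, T, rfl⟩
  exact h S T

theorem cutNorm_nonneg {n : ℕ} (A : Matrix (Fin n) (Fin n) ℝ) : 0 ≤ cutNorm A := by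
  refine mul_nonneg (by positivity) (Real.sSup_nonneg ?_)
  rintro r ⟨S, T, rfl⟩
  exact abs_nonneg _

theorem cutNorm_tri_le {n : ℕ} (hn : 0 < n) (A : Matrix (Fin n) (Fin n) ℝ) :
    cutNorm (tri A) ≤ (n : ℝ) ^ 2 * cutNorm A := by
  have hA : 0 ≤ (n : ℝ) ^ 2 * cutNorm A := mul_nonneg (by positivity) (cutNorm_nonneg A)
  have entry (i j : Fin n) : |tri A i j| ≤ (n : ℝ) ^ 2 * cutNorm A := by
    unfold tri
    split_ifs
    · simpa using abs_sum_le_cutNorm hn A {i} {j}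
    · simpa using hA
  have hn' : (0 : ℝ) < n := by exact_mod_cast hn
  refine (cutNorm_le (tri A) (C := n * (n * ((n : ℝ) ^ 2 * cutNorm A))) fun S T => ?_).trans
    (le_of_eq (by field_simp))
  calc |∑ i ∈ S, ∑ j ∈ T, tri A i j|
      ≤ ∑ i ∈ S, ∑ j ∈ T, |tri A i j| :=
        (Finset.abs_sum_le_sum_abs _ _).trans
          (Finset.sum_le_sum fun i _ => Finset.abs_sum_le_sum_abs _ _)
    _ ≤ ∑ i : Fin n, ∑ j : Fin n, |tri A i j| :=
        (Finset.sum_le_sum fun i _ => Finset.sum_le_univ_sum_of_nonneg fun j => abs_nonneg _).trans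
          (Finset.sum_le_univ_sum_of_nonneg fun i => Finset.sum_nonneg fun j _ => abs_nonneg _)
    _ ≤ ∑ i : Fin n, ∑ j : Fin n, (n : ℝ) ^ 2 * cutNorm A :=
        Finset.sum_le_sum fun i _ => Finset.sum_le_sum fun j _ => entry i j
    _ = n * (n * ((n : ℝ) ^ 2 * cutNorm A)) := by simp

theorem integral_cos_int_mul (k : ℤ) :
    ∫ t in (0 : ℝ)..Real.pi, Real.cos (k * t) = if k = 0 then Real.pi else 0 := by
  split_ifs with h
  · simp [h]
  · rw [intervalIntegral.integral_comp_mul_left _ (Int.cast_ne_zero.mpr h)]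
    simp

theorem integral_sin_odd_mul {k : ℤ} (hk : Odd k) :
    ∫ t in (0 : ℝ)..Real.pi, Real.sin (k * t) = 2 * (1 / (k : ℝ)) := by
  have h : (k : ℝ) ≠ 0 := by
    have : k ≠ 0 := by rintro rfl; simp at hk
    exact_mod_cast this
  rw [intervalIntegral.integral_comp_mul_left _ h]
  have : Real.cos (k * Real.pi) = -1 := by
    rw [Real.cos_int_mul_pi, hk.neg_one_zpow]
  simp [this]
  ring

theorem sum_cos_sub {ι : Type*} (S : Finset ι) (x : ι → ℝ) :
    ∑ i ∈ S, ∑ j ∈ S, Real.cos (x i - x j) =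
      (∑ i ∈ S, Real.cos (x i)) ^ 2 + (∑ i ∈ S, Real.sin (x i)) ^ 2 := by
  simp only [Real.cos_sub, Finset.sum_add_distrib, sq, Finset.sum_mul_sum]

theorem abs_sum_sin_sub_le {ι : Type*} (S T : Finset ι) (x : ι → ℝ) :
    |∑ i ∈ S, ∑ j ∈ T, Real.sin (x i - x j)| ≤
      ((∑ i ∈ S, ∑ j ∈ S, Real.cos (x i - x j)) +
        ∑ i ∈ T, ∑ j ∈ T, Real.cos (x i - x j)) / 2 := by
  rw [sum_cos_sub, sum_cos_sub]
  simp only [Real.sin_sub, Finset.sum_sub_distrib, ← Finset.sum_mul_sum]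
  set a := ∑ i ∈ S, Real.sin (x i)
  set b := ∑ i ∈ S, Real.cos (x i)
  set c := ∑ i ∈ T, Real.sin (x i)
  set d := ∑ i ∈ T, Real.cos (x i)
  rw [abs_le]
  constructor
  · nlinarith [sq_nonneg (a + d), sq_nonneg (b - c)]
  · nlinarith [sq_nonneg (a - d), sq_nonneg (b + c)]

theorem integral_sum_cos {n : ℕ} (S : Finset (Fin n)) :
    ∫ t in (0 : ℝ)..Real.pi, ∑ i ∈ S, ∑ j ∈ S, Real.cos ((i : ℝ) * t - (j : ℝ) * t) =
      Real.pi * S.card := by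
  rw [intervalIntegral.integral_finsetSum
    fun i _ => Continuous.intervalIntegrable (by fun_prop) _ _]
  have h (i : Fin n) (hi : i ∈ S) :
      ∫ t in (0 : ℝ)..Real.pi, ∑ j ∈ S, Real.cos ((i : ℝ) * t - (j : ℝ) * t) = Real.pi := by
    rw [intervalIntegral.integral_finsetSum
      fun i _ => Continuous.intervalIntegrable (by fun_prop) _ _]
    have (j : Fin n) : ∫ t in (0 : ℝ)..Real.pi, Real.cos ((i : ℝ) * t - (j : ℝ) * t) =
        if i = j then Real.pi else 0 := by
      have := integral_cos_int_mul ((i : ℤ) - (j : ℤ))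
      push_cast at this
      simpa [sub_mul, sub_eq_zero, Fin.ext_iff] using this
    simp [this, hi]
  rw [Finset.sum_congr rfl h]
  simp [mul_comm]

/-- Hilbert's inequality for indicator vectors with supports of opposite parity. -/
theorem abs_sum_one_div_sub_le {n : ℕ} (S T : Finset (Fin n))
    (h : ∀ i ∈ S, ∀ j ∈ T, Odd ((i : ℤ) - (j : ℤ))) :
    |∑ i ∈ S, ∑ j ∈ T, 1 / ((i : ℝ) - (j : ℝ))| ≤ Real.pi * n / 2 := by
  have hint : ∫ t in (0 : ℝ)..Real.pi, ∑ i ∈ S, ∑ j ∈ T, Real.sin ((i : ℝ) * t - (j : ℝ) * t) =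
      2 * ∑ i ∈ S, ∑ j ∈ T, 1 / ((i : ℝ) - (j : ℝ)) := by
    rw [intervalIntegral.integral_finsetSum
      fun i _ => Continuous.intervalIntegrable (by fun_prop) _ _, Finset.mul_sum]
    refine Finset.sum_congr rfl fun i hi => ?_
    rw [intervalIntegral.integral_finsetSum
      fun i _ => Continuous.intervalIntegrable (by fun_prop) _ _, Finset.mul_sum]
    refine Finset.sum_congr rfl fun j hj => ?_
    have := integral_sin_odd_mul (h i hi j hj)
    push_cast at this
    simpa only [sub_mul] using this
  have hle : |2 * ∑ i ∈ S, ∑ j ∈ T, 1 / ((i : ℝ) - (j : ℝ))| ≤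
      (Real.pi * S.card + Real.pi * T.card) / 2 := by
    rw [← hint, ← integral_sum_cos S, ← integral_sum_cos T,
      ← intervalIntegral.integral_add (Continuous.intervalIntegrable (by fun_prop) _ _)
        (Continuous.intervalIntegrable (by fun_prop) _ _), ← intervalIntegral.integral_div]
    refine (intervalIntegral.abs_integral_le_integral_abs Real.pi_pos.le).trans ?_
    refine intervalIntegral.integral_mono_on Real.pi_pos.le
      (Continuous.intervalIntegrable (by fun_prop) _ _)
      (Continuous.intervalIntegrable (by fun_prop) _ _) fun t _ => ?_
    exact abs_sum_sin_sub_le S T fun i => (i : ℝ) * t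
  have hS : (S.card : ℝ) ≤ n := by exact_mod_cast card_finset_fin_le S
  have hT : (T.card : ℝ) ≤ n := by exact_mod_cast card_finset_fin_le T
  rw [abs_mul, abs_two] at hle
  nlinarith [Real.pi_pos, mul_le_mul_of_nonneg_left hS Real.pi_pos.le,
    mul_le_mul_of_nonneg_left hT Real.pi_pos.le]

/-- The Hilbert matrix `1 / (i - j)` restricted to even rows and odd columns. -/
noncomputable def evenOddHilbert (n : ℕ) : Matrix (Fin n) (Fin n) ℝ :=
  fun i j => if Even (i : ℕ) ∧ Odd (j : ℕ) then 1 / ((i : ℝ) - (j : ℝ)) else 0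

theorem abs_sum_evenOddHilbert_le {n : ℕ} (S T : Finset (Fin n)) :
    |∑ i ∈ S, ∑ j ∈ T, evenOddHilbert n i j| ≤ Real.pi * n / 2 := by
  have key := abs_sum_one_div_sub_le (S.filter fun i => Even (i : ℕ))
    (T.filter fun j => Odd (j : ℕ)) (by
      intro i hi j hj
      have hi' : Even ((i : ℕ) : ℤ) := by exact_mod_cast (Finset.mem_filter.mp hi).2
      have hj' : Odd ((j : ℕ) : ℤ) := by exact_mod_cast (Finset.mem_filter.mp hj).2
      exact hi'.sub_odd hj')
  convert key using 2
  rw [Finset.sum_filter]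
  refine Finset.sum_congr rfl fun i _ => ?_
  rw [Finset.sum_filter]
  by_cases hi : Even (i : ℕ) <;> simp only [evenOddHilbert, hi, true_and, false_and, if_true,
    if_false, Finset.sum_const_zero]

/-- The symmetrization of `evenOddHilbert n`. -/
noncomputable def symmHilbert (n : ℕ) : Matrix (Fin n) (Fin n) ℝ :=
  evenOddHilbert n + (evenOddHilbert n).transpose

theorem symmHilbert_isSymm (n : ℕ) : (symmHilbert n).IsSymm :=
  Matrix.isSymm_add_transpose_self _

theorem cutNorm_symmHilbert_le (n : ℕ) :
    cutNorm (symmHilbert n) ≤ Real.pi * n / (n : ℝ) ^ 2 := by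
  refine cutNorm_le _ fun S T => ?_
  have h₁ := abs_sum_evenOddHilbert_le S T
  have h₂ := abs_sum_evenOddHilbert_le T S
  have hcomm : ∑ i ∈ S, ∑ j ∈ T, evenOddHilbert n j i = ∑ j ∈ T, ∑ i ∈ S, evenOddHilbert n j i :=
    Finset.sum_comm
  rw [← hcomm] at h₂
  simp only [symmHilbert, Matrix.add_apply, Matrix.transpose_apply, Finset.sum_add_distrib]
  exact (abs_add_le _ _).trans (by linarith)

theorem symmHilbert_even_odd {n : ℕ} (i j : Fin n) (hi : Even (i : ℕ)) (hj : Odd (j : ℕ)) :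
    symmHilbert n i j = 1 / ((i : ℝ) - (j : ℝ)) := by
  simp [symmHilbert, evenOddHilbert, hi, hj]

theorem cutNorm_symmHilbert_pos {n : ℕ} (hn : 2 ≤ n) : 0 < cutNorm (symmHilbert n) := by
  refine (cutNorm_nonneg _).lt_of_ne fun h => ?_
  have := abs_sum_le_cutNorm (by omega) (symmHilbert n) {⟨0, by omega⟩} {⟨1, by omega⟩}
  rw [← h, Finset.sum_singleton, Finset.sum_singleton,
    symmHilbert_even_odd _ _ (by simp) (by simp)] at this
  norm_num at this

theorem harmonic_le_sum_tri_symmHilbert {n m : ℕ} (hm : 4 * m ≤ n) :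
    (m : ℝ) * ((∑ k ∈ Finset.range m, 1 / ((k : ℝ) + 1)) / 2) ≤
      (n : ℝ) ^ 2 * cutNorm (tri (symmHilbert n)) := by
  rcases Nat.eq_zero_or_pos m with rfl | hm0
  · simpa using mul_nonneg (sq_nonneg (n : ℝ)) (cutNorm_nonneg _)
  let e : Fin m → Fin n := fun a => ⟨2 * (m + a), by omega⟩
  let f : Fin (2 * m) → Fin n := fun b => ⟨2 * b + 1, by omega⟩
  have he : Function.Injective e := fun a b h => by
    simp only [e, Fin.mk.injEq] at h
    exact Fin.ext (by omega)
  have hf : Function.Injective f := fun a b h => by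
    simp only [f, Fin.mk.injEq] at h
    exact Fin.ext (by omega)
  refine le_trans ?_ (abs_sum_le_cutNorm (by omega) (tri (symmHilbert n))
    (Finset.univ.map ⟨e, he⟩) (Finset.univ.map ⟨f, hf⟩))
  refine le_trans ?_ (le_abs_self _)
  simp only [Finset.sum_map, Function.Embedding.coeFn_mk]
  have entry (a : Fin m) (b : Fin (2 * m)) : tri (symmHilbert n) (e a) (f b) =
      if (b : ℕ) < m + a then 1 / (2 * ((m : ℝ) + a) - (2 * b + 1)) else 0 := by
    unfold tri
    have : f b ≤ e a ↔ (b : ℕ) < m + a := by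
      simp only [e, f, Fin.mk_le_mk]
      omega
    simp only [this]
    rw [symmHilbert_even_odd (e a) (f b) (by simp [e]) (by simp [f])]
    simp [e, f]
  have row (a : Fin m) : (∑ k ∈ Finset.range m, 1 / ((k : ℝ) + 1)) / 2 ≤
      ∑ b, tri (symmHilbert n) (e a) (f b) := by
    let g : Fin m → Fin (2 * m) := fun k => ⟨m + a - 1 - k, by omega⟩
    have hg : Function.Injective g := fun k l h => by
      simp only [g, Fin.mk.injEq] at h
      exact Fin.ext (by omega)
    have hnonneg (b : Fin (2 * m)) : 0 ≤ tri (symmHilbert n) (e a) (f b) := by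
      rw [entry]
      split_ifs with hb
      · have : (b : ℝ) + 1 ≤ m + a := by exact_mod_cast hb
        exact one_div_nonneg.mpr (by linarith)
      · exact le_rfl
    refine le_trans ?_ (Finset.sum_le_univ_sum_of_nonneg hnonneg (s := Finset.univ.map ⟨g, hg⟩))
    rw [Finset.sum_map, ← Fin.sum_univ_eq_sum_range (fun k => 1 / ((k : ℝ) + 1)), Finset.sum_div]
    refine Finset.sum_le_sum fun k _ => ?_
    have hcast : ((g k : ℕ) : ℝ) = m + a - 1 - k := by
      have : (g k : ℕ) + 1 + k = m + a := by
        simp only [g]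
        omega
      have : ((g k : ℕ) : ℝ) + 1 + k = m + a := by exact_mod_cast this
      linarith
    rw [Function.Embedding.coeFn_mk, entry, if_pos (by simp only [g]; omega), hcast, div_div]
    have hk : (0 : ℝ) ≤ k := Nat.cast_nonneg _
    exact one_div_le_one_div_of_le (by linarith) (by linarith)
  calc (m : ℝ) * ((∑ k ∈ Finset.range m, 1 / ((k : ℝ) + 1)) / 2)
      = ∑ _a : Fin m, (∑ k ∈ Finset.range m, 1 / ((k : ℝ) + 1)) / 2 := by simp
    _ ≤ _ := Finset.sum_le_sum fun a _ => row a

theorem harmonic_le_cutNorm_ratio {n : ℕ} (hn : 4 ≤ n) :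
    (∑ k ∈ Finset.range (n / 4), 1 / ((k : ℝ) + 1)) / (16 * Real.pi) ≤
      cutNorm (tri (symmHilbert n)) / cutNorm (symmHilbert n) := by
  have hlow := harmonic_le_sum_tri_symmHilbert (n := n) (m := n / 4) (by omega)
  have hup := cutNorm_symmHilbert_le n
  have hn0 : (0 : ℝ) < n := by exact_mod_cast (by omega : 0 < n)
  have hm : (n : ℝ) ≤ 8 * (n / 4 : ℕ) := by exact_mod_cast (by omega : n ≤ 8 * (n / 4))
  set m : ℕ := n / 4
  set H := ∑ k ∈ Finset.range m, 1 / ((k : ℝ) + 1)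
  have hH : 0 ≤ H := Finset.sum_nonneg fun k _ => by positivity
  rw [le_div_iff₀ (cutNorm_symmHilbert_pos (by omega))]
  have hpi := Real.pi_pos
  calc H / (16 * Real.pi) * cutNorm (symmHilbert n)
      ≤ H / (16 * Real.pi) * (Real.pi * n / (n : ℝ) ^ 2) := by gcongr
    _ = (n * H / 16) / (n : ℝ) ^ 2 := by field_simp
    _ ≤ cutNorm (tri (symmHilbert n)) := by
        rw [div_le_iff₀ (by positivity)]
        nlinarith [mul_le_mul_of_nonneg_right hm hH]

/-- `sup_{A ∈ Sₙ(ℝ), ‖A‖_□ ≠ 0} ‖𝒯ₙ(A)‖_□ / ‖A‖_□ → ∞` as `n → ∞`,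
where the supremum is over symmetric matrices. -/
theorem triCut_cutNorm_unbounded_symm :
    Tendsto
      (fun n : ℕ => sSup {r : ℝ | ∃ A : Matrix (Fin n) (Fin n) ℝ,
        A.IsSymm ∧ cutNorm A ≠ 0 ∧ r = cutNorm (tri A) / cutNorm A})
      atTop atTop := by
  have hlim : Tendsto
      (fun n : ℕ => (∑ k ∈ Finset.range (n / 4), 1 / ((k : ℝ) + 1)) / (16 * Real.pi))
      atTop atTop :=
    (Real.tendsto_sum_range_one_div_nat_succ_atTop.comp
      (Nat.tendsto_div_const_atTop (by norm_num))).atTop_div_const (by positivity)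
  refine tendsto_atTop_mono' atTop ?_ hlim
  filter_upwards [eventually_ge_atTop 4] with n hn
  refine (harmonic_le_cutNorm_ratio hn).trans (le_csSup ⟨(n : ℝ) ^ 2, ?_⟩
    ⟨_, symmHilbert_isSymm n, (cutNorm_symmHilbert_pos (by omega)).ne', rfl⟩)
  rintro r ⟨A, -, hA, rfl⟩
  rw [div_le_iff₀ ((cutNorm_nonneg A).lt_of_ne' hA)]
  exact cutNorm_tri_le (by omega) A
end

section
/- Let w ∈ L¹([0,1]²) and let 0 < λ ≤ 1/2. Define w_λ(x,y) = w(x/λ, y/λ − (1−λ)/λ) for (x,y) ∈ [0,λ] × [1−λ,1] and w_λ(x,y) = 0 otherwise, and define w̄_λ(x,y) = w_λ(y,x). Then ‖w_λ + w̄_λ‖_□ = 2λ²·‖w‖_□. -/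
open MeasureTheory Filter

/-- Cut norm of a function on `[0,1]²`:
`sup_{S,T ⊆ [0,1] measurable} |∫_{S×T} w(x,y) dx dy|`. -/
noncomputable def cutNormFn (w : ℝ → ℝ → ℝ) : ℝ :=
  sSup {r : ℝ | ∃ S T : Set ℝ, MeasurableSet S ∧ MeasurableSet T ∧
    S ⊆ Set.Icc 0 1 ∧ T ⊆ Set.Icc 0 1 ∧ r = |∫ p in S ×ˢ T, w p.1 p.2|}

/-- Pulling back the indicator of a rectangle along the affine map that carries `[0,1]²` onto
the corner square `[0,lam] × [1-lam,1]`. -/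
theorem indicator_corner_copy (w wl : ℝ → ℝ → ℝ) (lam : ℝ) (hlam0 : 0 < lam)
    (hwl : ∀ x y : ℝ, wl x y =
      if x ∈ Set.Icc 0 lam ∧ y ∈ Set.Icc (1 - lam) 1
        then w (x / lam) (y / lam - (1 - lam) / lam) else 0)
    (S T : Set ℝ) (p : ℝ × ℝ) :
    (S ×ˢ T).indicator (fun p : ℝ × ℝ => wl p.1 p.2) p =
      ((Set.Icc 0 1 ∩ (fun u => lam * u) ⁻¹' S) ×ˢ
        (Set.Icc 0 1 ∩ (fun v => lam * v + (1 - lam)) ⁻¹' T)).indicator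
          (fun p : ℝ × ℝ => w p.1 p.2) (lam⁻¹ • (p + (0, -(1 - lam)))) := by
  obtain ⟨x, y⟩ := p
  have hx : lam * (lam⁻¹ * x) = x := by field_simp
  have hy : lam * (lam⁻¹ * (y + -(1 - lam))) + (1 - lam) = y := by field_simp; ring
  have hx1 : lam⁻¹ * x ∈ Set.Icc (0 : ℝ) 1 ↔ x ∈ Set.Icc 0 lam := by
    rw [inv_mul_eq_div, Set.mem_Icc, Set.mem_Icc, div_le_one hlam0, le_div_iff₀ hlam0, zero_mul]
  have hy1 : lam⁻¹ * (y + -(1 - lam)) ∈ Set.Icc (0 : ℝ) 1 ↔ y ∈ Set.Icc (1 - lam) 1 := by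
    rw [inv_mul_eq_div, Set.mem_Icc, Set.mem_Icc, div_le_one hlam0, le_div_iff₀ hlam0, zero_mul]
    constructor <;> rintro ⟨h, h'⟩ <;> constructor <;> linarith
  have hx2 : x / lam = lam⁻¹ * x := by field_simp
  have hy2 : y / lam - (1 - lam) / lam = lam⁻¹ * (y + -(1 - lam)) := by field_simp; ring
  classical
  simp only [Set.indicator_apply, Set.mem_prod, Set.mem_inter_iff, Set.mem_preimage,
    Prod.mk_add_mk, Prod.smul_mk, smul_eq_mul, add_zero, hx, hy, hx1, hy1, hwl, hx2, hy2]
  split_ifs <;> tauto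

theorem setIntegral_corner_copy (w wl : ℝ → ℝ → ℝ) (lam : ℝ) (hlam0 : 0 < lam)
    (hwl : ∀ x y : ℝ, wl x y =
      if x ∈ Set.Icc 0 lam ∧ y ∈ Set.Icc (1 - lam) 1
        then w (x / lam) (y / lam - (1 - lam) / lam) else 0)
    {S T : Set ℝ} (hS : MeasurableSet S) (hT : MeasurableSet T) :
    ∫ p in S ×ˢ T, wl p.1 p.2 = lam ^ 2 *
      ∫ p in (Set.Icc 0 1 ∩ (fun u => lam * u) ⁻¹' S) ×ˢ
        (Set.Icc 0 1 ∩ (fun v => lam * v + (1 - lam)) ⁻¹' T), w p.1 p.2 := by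
  have hS' : MeasurableSet (Set.Icc 0 1 ∩ (fun u => lam * u) ⁻¹' S) :=
    measurableSet_Icc.inter (measurableSet_preimage (by fun_prop) hS)
  have hT' : MeasurableSet (Set.Icc 0 1 ∩ (fun v => lam * v + (1 - lam)) ⁻¹' T) :=
    measurableSet_Icc.inter (measurableSet_preimage (by fun_prop) hT)
  rw [← integral_indicator (hS.prod hT), ← integral_indicator (hS'.prod hT')]
  simp_rw [indicator_corner_copy w wl lam hlam0 hwl S T]
  rw [integral_add_right_eq_self (μ := (volume : Measure (ℝ × ℝ)))
    (fun q : ℝ × ℝ => ((Set.Icc 0 1 ∩ (fun u => lam * u) ⁻¹' S) ×ˢ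
        (Set.Icc 0 1 ∩ (fun v => lam * v + (1 - lam)) ⁻¹' T)).indicator
          (fun p : ℝ × ℝ => w p.1 p.2) (lam⁻¹ • q)), Measure.integral_comp_smul]
  simp [abs_of_pos hlam0]

theorem integrable_corner_copy (w wl : ℝ → ℝ → ℝ) (lam : ℝ) (hlam0 : 0 < lam)
    (hw : IntegrableOn (fun p : ℝ × ℝ => w p.1 p.2) (Set.Icc 0 1 ×ˢ Set.Icc 0 1))
    (hwl : ∀ x y : ℝ, wl x y =
      if x ∈ Set.Icc 0 lam ∧ y ∈ Set.Icc (1 - lam) 1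
        then w (x / lam) (y / lam - (1 - lam) / lam) else 0) :
    Integrable (fun p : ℝ × ℝ => wl p.1 p.2) := by
  have h := (((integrable_indicator_iff
    (measurableSet_Icc.prod measurableSet_Icc)).2 hw).comp_smul
      (inv_ne_zero hlam0.ne')).comp_add_right (0, -(1 - lam))
  refine h.congr (ae_of_all _ fun p => ?_)
  simpa using (indicator_corner_copy w wl lam hlam0 hwl Set.univ Set.univ p).symm

theorem bddAbove_cutNormFn (w : ℝ → ℝ → ℝ)
    (hw : IntegrableOn (fun p : ℝ × ℝ => w p.1 p.2) (Set.Icc 0 1 ×ˢ Set.Icc 0 1)) :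
    BddAbove {r : ℝ | ∃ S T : Set ℝ, MeasurableSet S ∧ MeasurableSet T ∧
      S ⊆ Set.Icc 0 1 ∧ T ⊆ Set.Icc 0 1 ∧ r = |∫ p in S ×ˢ T, w p.1 p.2|} := by
  refine ⟨∫ p in Set.Icc (0 : ℝ) 1 ×ˢ Set.Icc (0 : ℝ) 1, |w p.1 p.2|, ?_⟩
  rintro r ⟨S, T, -, -, hS, hT, rfl⟩
  exact (abs_integral_le_integral_abs).trans (setIntegral_mono_set hw.abs
    (ae_of_all _ fun _ => abs_nonneg _) (Set.prod_mono hS hT).eventuallyLE)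

theorem abs_setIntegral_le_cutNormFn (w : ℝ → ℝ → ℝ)
    (hw : IntegrableOn (fun p : ℝ × ℝ => w p.1 p.2) (Set.Icc 0 1 ×ˢ Set.Icc 0 1))
    {S T : Set ℝ} (hS : MeasurableSet S) (hT : MeasurableSet T)
    (hS1 : S ⊆ Set.Icc 0 1) (hT1 : T ⊆ Set.Icc 0 1) :
    |∫ p in S ×ˢ T, w p.1 p.2| ≤ cutNormFn w :=
  le_csSup (bddAbove_cutNormFn w hw) ⟨S, T, hS, hT, hS1, hT1, rfl⟩

theorem cutNormFn_le (w : ℝ → ℝ → ℝ) (C : ℝ)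
    (h : ∀ S T : Set ℝ, MeasurableSet S → MeasurableSet T → S ⊆ Set.Icc 0 1 →
      T ⊆ Set.Icc 0 1 → |∫ p in S ×ˢ T, w p.1 p.2| ≤ C) :
    cutNormFn w ≤ C := by
  refine csSup_le ⟨_, ∅, ∅, .empty, .empty, Set.empty_subset _, Set.empty_subset _, rfl⟩ ?_
  rintro r ⟨S, T, hS, hT, hS1, hT1, rfl⟩
  exact h S T hS hT hS1 hT1

theorem setIntegral_add_swap (f : ℝ → ℝ → ℝ) (hf : Integrable (fun p : ℝ × ℝ => f p.1 p.2))
    (S T : Set ℝ) :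
    ∫ p in S ×ˢ T, (f p.1 p.2 + f p.2 p.1) =
      (∫ p in S ×ˢ T, f p.1 p.2) + ∫ p in T ×ˢ S, f p.1 p.2 := by
  have hswap : Integrable (fun p : ℝ × ℝ => f p.2 p.1) := hf.swap
  rw [integral_add hf.integrableOn hswap.integrableOn]
  congr 1
  exact setIntegral_prod_swap T S (fun p : ℝ × ℝ => f p.1 p.2)

/-- For `w ∈ L¹([0,1]²)` and `0 < λ ≤ 1/2`, with
`w_λ(x,y) = w(x/λ, y/λ - (1-λ)/λ)` on `[0,λ] × [1-λ,1]` and `0` otherwise, and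
`w̄_λ(x,y) = w_λ(y,x)`, one has `‖w_λ + w̄_λ‖_□ = 2λ²·‖w‖_□`. -/
theorem cutNorm_corner_copies (w : ℝ → ℝ → ℝ)
    (hw : IntegrableOn (fun p : ℝ × ℝ => w p.1 p.2) (Set.Icc 0 1 ×ˢ Set.Icc 0 1))
    (lam : ℝ) (hlam0 : 0 < lam) (hlam : lam ≤ 1 / 2)
    (wl : ℝ → ℝ → ℝ)
    (hwl : ∀ x y : ℝ, wl x y =
      if x ∈ Set.Icc 0 lam ∧ y ∈ Set.Icc (1 - lam) 1
        then w (x / lam) (y / lam - (1 - lam) / lam) else 0) :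
    cutNormFn (fun x y => wl x y + wl y x) = 2 * lam ^ 2 * cutNormFn w := by
  have hint := integrable_corner_copy w wl lam hlam0 hw hwl
  have key := fun {S T : Set ℝ} => setIntegral_corner_copy w wl lam hlam0 hwl (S := S) (T := T)
  have hpos : 0 < 2 * lam ^ 2 := by positivity
  apply le_antisymm
  · refine cutNormFn_le _ _ fun S T hS hT _ _ => ?_
    have bound : ∀ {S T : Set ℝ}, MeasurableSet S → MeasurableSet T →
        |∫ p in S ×ˢ T, wl p.1 p.2| ≤ lam ^ 2 * cutNormFn w := by
      intro S T hS hT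
      rw [key hS hT, abs_mul, abs_of_nonneg (sq_nonneg lam)]
      exact mul_le_mul_of_nonneg_left (abs_setIntegral_le_cutNormFn w hw
        (measurableSet_Icc.inter (measurableSet_preimage (by fun_prop) hS))
        (measurableSet_Icc.inter (measurableSet_preimage (by fun_prop) hT))
        Set.inter_subset_left Set.inter_subset_left) (sq_nonneg lam)
    rw [setIntegral_add_swap wl hint]
    linarith [abs_add_le (∫ p in S ×ˢ T, wl p.1 p.2) (∫ p in T ×ˢ S, wl p.1 p.2),
      bound hS hT, bound hT hS]
  · rw [mul_comm, ← le_div_iff₀ hpos]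
    refine cutNormFn_le _ _ fun S T hS hT hS1 hT1 => ?_
    rw [le_div_iff₀ hpos]
    -- The points `1 ∈ S` and `0 ∈ T` are dropped so that the two scaled copies are disjoint.
    set R : Set ℝ := (fun x => lam⁻¹ * x) ⁻¹' (S \ {1}) ∪
      (fun y => lam⁻¹ * (y - (1 - lam))) ⁻¹' (T \ {0}) with hR
    have hRm : MeasurableSet R :=
      (measurableSet_preimage (by fun_prop) (hS.diff (measurableSet_singleton _))).union
        (measurableSet_preimage (by fun_prop) (hT.diff (measurableSet_singleton _)))
    have hR1 : R ⊆ Set.Icc 0 1 := by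
      rintro x (⟨hx, -⟩ | ⟨hx, -⟩)
      · obtain ⟨h0, h1⟩ := hS1 hx
        beta_reduce at h0 h1
        rw [inv_mul_eq_div, le_div_iff₀ hlam0] at h0
        rw [inv_mul_eq_div, div_le_one hlam0] at h1
        constructor <;> linarith
      · obtain ⟨h0, h1⟩ := hT1 hx
        beta_reduce at h0 h1
        rw [inv_mul_eq_div, le_div_iff₀ hlam0] at h0
        rw [inv_mul_eq_div, div_le_one hlam0] at h1
        constructor <;> linarith
    have hleft : Set.Icc 0 1 ∩ (fun u => lam * u) ⁻¹' R = S \ {1} := by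
      ext u
      have hu : lam⁻¹ * (lam * u) = u := by field_simp
      simp only [hR, Set.mem_inter_iff, Set.mem_preimage, Set.mem_union, hu]
      refine ⟨?_, fun h => ⟨hS1 h.1, Or.inl h⟩⟩
      rintro ⟨⟨-, hu1⟩, h | ⟨h, h0⟩⟩
      · exact h
      · have h2 : 0 < lam⁻¹ * (lam * u - (1 - lam)) := lt_of_le_of_ne (hT1 h).1 (Ne.symm h0)
        rw [inv_mul_eq_div, lt_div_iff₀ hlam0] at h2
        nlinarith
    have hright : Set.Icc 0 1 ∩ (fun v => lam * v + (1 - lam)) ⁻¹' R = T \ {0} := by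
      ext v
      have hv : lam⁻¹ * (lam * v + (1 - lam) - (1 - lam)) = v := by field_simp; ring
      simp only [hR, Set.mem_inter_iff, Set.mem_preimage, Set.mem_union, hv]
      refine ⟨?_, fun h => ⟨hT1 h.1, Or.inr h⟩⟩
      rintro ⟨⟨hv0, -⟩, ⟨h, h1⟩ | h⟩
      · have h2 : lam⁻¹ * (lam * v + (1 - lam)) < 1 := lt_of_le_of_ne (hS1 h).2 h1
        rw [inv_mul_eq_div, div_lt_one hlam0] at h2
        nlinarith
      · exact h
    have hae : ((S \ {1}) ×ˢ (T \ {0}) : Set (ℝ × ℝ)) =ᵐ[volume] S ×ˢ T :=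
      Measure.set_prod_ae_eq (sdiff_null_ae_eq_self Real.volume_singleton)
        (sdiff_null_ae_eq_self Real.volume_singleton)
    have hval : ∫ p in R ×ˢ R, (wl p.1 p.2 + wl p.2 p.1) =
        2 * lam ^ 2 * ∫ p in S ×ˢ T, w p.1 p.2 := by
      rw [setIntegral_add_swap wl hint, key hRm hRm, hleft, hright, setIntegral_congr_set hae]
      ring
    have hle := abs_setIntegral_le_cutNormFn (fun x y => wl x y + wl y x)
      (hint.add hint.swap).integrableOn hRm hRm hR1 hR1
    rw [hval, abs_mul, abs_of_pos hpos] at hle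
    linarith
end

section
/- For every positive integer n, the ℓ²→ℓ² operator norm of the n × n matrix A_n, defined by (A_n)_{ij} = 0 for i = j and (A_n)_{ij} = 1/(i−j) for i ≠ j, satisfies ‖A_n‖_opr ≤ π. -/
open MeasureTheory Filter

/-- The `ℓ² → ℓ²` operator norm of an `n × n` real matrix:
`sup_{‖x‖₂ ≤ 1} ‖Ax‖₂`. -/
noncomputable def oprNorm {n : ℕ} (A : Matrix (Fin n) (Fin n) ℝ) : ℝ :=
  sSup {r : ℝ | ∃ x : Fin n → ℝ, (∑ j, (x j) ^ 2) ≤ 1 ∧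
    r = Real.sqrt (∑ i, (∑ j, A i j * x j) ^ 2)}
/-- The matrix `A_n` with `(A_n)_{ij} = 0` for `i = j` and `1/(i-j)` for `i ≠ j`. -/
noncomputable def An (n : ℕ) : Matrix (Fin n) (Fin n) ℝ :=
  fun i j => if i = j then 0 else 1 / (((i : ℕ) : ℝ) - ((j : ℕ) : ℝ))

open Real in
theorem integral_cos_int_mul_s12 {k : ℤ} (hk : k ≠ 0) :
    ∫ t in (0 : ℝ)..2 * π, cos (k * t) = 0 := by
  have hk' : (k : ℝ) ≠ 0 := by exact_mod_cast hk
  rw [intervalIntegral.integral_comp_mul_left (fun t => cos t) hk', integral_cos]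
  have h : sin (k * (2 * π)) = 0 := by
    simpa using sin_add_int_mul_two_pi 0 k
  simp [h]

open Real in
theorem integral_pi_sub_mul_sin_int_mul {k : ℤ} (hk : k ≠ 0) :
    ∫ t in (0 : ℝ)..2 * π, (π - t) * sin (k * t) = 2 * π * (1 / k) := by
  have hk' : (k : ℝ) ≠ 0 := by exact_mod_cast hk
  have hderiv : ∀ t ∈ Set.uIcc 0 (2 * π), HasDerivAt
      (fun t : ℝ => -((π - t) * cos (k * t)) / k - sin (k * t) / k ^ 2)
      ((π - t) * sin (k * t)) t := by
    intro t _
    have hlin : HasDerivAt (fun t : ℝ => (k : ℝ) * t) k t := by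
      simpa using (hasDerivAt_id t).const_mul (k : ℝ)
    have hsub : HasDerivAt (fun t : ℝ => π - t) (-1) t := by
      simpa using (hasDerivAt_id t).const_sub π
    refine ((((hsub.mul hlin.cos).neg).div_const (k : ℝ)).sub
      (hlin.sin.div_const ((k : ℝ) ^ 2))).congr_deriv ?_
    field_simp
    ring
  rw [intervalIntegral.integral_eq_sub_of_hasDerivAt hderiv
    (Continuous.intervalIntegrable (by fun_prop) _ _)]
  have hs : sin (k * (2 * π)) = 0 := by
    simpa using sin_add_int_mul_two_pi 0 k
  have hc : cos (k * (2 * π)) = 1 := by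
    simp
  rw [hs, hc]
  simp only [mul_zero, cos_zero, sin_zero]
  field_simp
  ring

open Real in
theorem integral_cos_sub_mul {n : ℕ} (i j : Fin n) :
    ∫ t in (0 : ℝ)..2 * π, cos (((i : ℕ) - (j : ℕ) : ℝ) * t) = if i = j then 2 * π else 0 := by
  split_ifs with h
  · simp [h]
  · have hk : ((i : ℕ) - (j : ℕ) : ℤ) ≠ 0 := by
      have := Fin.val_ne_of_ne h
      lia
    simpa using integral_cos_int_mul_s12 hk

open Real in
theorem integral_pi_sub_mul_sin_sub_mul {n : ℕ} (i j : Fin n) :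
    ∫ t in (0 : ℝ)..2 * π, (π - t) * sin (((i : ℕ) - (j : ℕ) : ℝ) * t) = 2 * π * An n i j := by
  unfold An
  split_ifs with h
  · simp [h]
  · have hk : ((i : ℕ) - (j : ℕ) : ℤ) ≠ 0 := by
      have := Fin.val_ne_of_ne h
      lia
    simpa using integral_pi_sub_mul_sin_int_mul hk

open Real in
theorem sum_sum_mul_cos_sub_mul {n : ℕ} (x : Fin n → ℝ) (t : ℝ) :
    ∑ i, ∑ j, x i * x j * cos (((i : ℕ) - (j : ℕ) : ℝ) * t) =
      (∑ i, x i * cos ((i : ℕ) * t)) ^ 2 + (∑ i, x i * sin ((i : ℕ) * t)) ^ 2 := by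
  simp only [sq, Finset.sum_mul_sum, ← Finset.sum_add_distrib]
  refine Finset.sum_congr rfl fun i _ => Finset.sum_congr rfl fun j _ => ?_
  rw [sub_mul, cos_sub]
  ring

open Real in
theorem sum_sum_mul_sin_sub_mul {n : ℕ} (x y : Fin n → ℝ) (t : ℝ) :
    ∑ i, ∑ j, y i * x j * sin (((i : ℕ) - (j : ℕ) : ℝ) * t) =
      (∑ i, y i * sin ((i : ℕ) * t)) * (∑ i, x i * cos ((i : ℕ) * t)) -
        (∑ i, y i * cos ((i : ℕ) * t)) * (∑ i, x i * sin ((i : ℕ) * t)) := by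
  simp only [Finset.sum_mul_sum, ← Finset.sum_sub_distrib]
  refine Finset.sum_congr rfl fun i _ => Finset.sum_congr rfl fun j _ => ?_
  rw [sub_mul, sin_sub]
  ring

open Real in
theorem integral_sum_sum_mul_cos_sub_mul {n : ℕ} (x : Fin n → ℝ) :
    ∫ t in (0 : ℝ)..2 * π, ∑ i, ∑ j, x i * x j * cos (((i : ℕ) - (j : ℕ) : ℝ) * t) =
      2 * π * ∑ i, x i ^ 2 := by
  rw [intervalIntegral.integral_finsetSum
    fun i _ => Continuous.intervalIntegrable (by fun_prop) _ _, Finset.mul_sum]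
  refine Finset.sum_congr rfl fun i _ => ?_
  rw [intervalIntegral.integral_finsetSum
    fun j _ => Continuous.intervalIntegrable (by fun_prop) _ _]
  simp only [intervalIntegral.integral_const_mul, integral_cos_sub_mul, mul_ite, mul_zero,
    Finset.sum_ite_eq, Finset.mem_univ, if_true]
  ring

open Real in
theorem integral_pi_sub_mul_sum_sum_mul_sin_sub_mul {n : ℕ} (x y : Fin n → ℝ) :
    ∫ t in (0 : ℝ)..2 * π,
        (π - t) * ∑ i, ∑ j, y i * x j * sin (((i : ℕ) - (j : ℕ) : ℝ) * t) =
      2 * π * ∑ i, y i * ∑ j, An n i j * x j := by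
  simp only [Finset.mul_sum]
  rw [intervalIntegral.integral_finsetSum
    fun i _ => Continuous.intervalIntegrable (by fun_prop) _ _]
  refine Finset.sum_congr rfl fun i _ => ?_
  rw [intervalIntegral.integral_finsetSum
    fun j _ => Continuous.intervalIntegrable (by fun_prop) _ _]
  refine Finset.sum_congr rfl fun j _ => ?_
  simp only [mul_left_comm (π - _), intervalIntegral.integral_const_mul,
    integral_pi_sub_mul_sin_sub_mul]
  ring

/-- The bilinear form of `An` is bounded by `π` times the arithmetic mean of the squared norms. -/
theorem neg_sum_mul_An_le {n : ℕ} (x y : Fin n → ℝ) :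
    -∑ i, y i * ∑ j, An n i j * x j ≤ Real.pi / 2 * (∑ i, x i ^ 2 + ∑ i, y i ^ 2) := by
  have hpi := Real.pi_pos
  have hnonneg : 0 ≤ ∫ t in (0 : ℝ)..2 * Real.pi,
      (Real.pi / 2 * (∑ i, ∑ j, x i * x j * Real.cos (((i : ℕ) - (j : ℕ) : ℝ) * t)) +
        Real.pi / 2 * (∑ i, ∑ j, y i * y j * Real.cos (((i : ℕ) - (j : ℕ) : ℝ) * t)) +
        (Real.pi - t) * ∑ i, ∑ j, y i * x j * Real.sin (((i : ℕ) - (j : ℕ) : ℝ) * t)) := by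
    refine intervalIntegral.integral_nonneg (by positivity) fun t ht => ?_
    rw [sum_sum_mul_cos_sub_mul, sum_sum_mul_cos_sub_mul, sum_sum_mul_sin_sub_mul]
    obtain ⟨ht0, ht1⟩ := ht
    generalize ∑ i, x i * Real.cos ((i : ℕ) * t) = a
    generalize ∑ i, x i * Real.sin ((i : ℕ) * t) = b
    generalize ∑ i, y i * Real.cos ((i : ℕ) * t) = c
    generalize ∑ i, y i * Real.sin ((i : ℕ) * t) = d
    have hplus : 0 ≤ (2 * Real.pi - t) * ((a + d) ^ 2 + (b - c) ^ 2) :=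
      mul_nonneg (by linarith) (by positivity)
    have hminus : 0 ≤ t * ((a - d) ^ 2 + (b + c) ^ 2) := mul_nonneg ht0 (by positivity)
    linarith
  rw [intervalIntegral.integral_add (Continuous.intervalIntegrable (by fun_prop) _ _)
      (Continuous.intervalIntegrable (by fun_prop) _ _),
    intervalIntegral.integral_add (Continuous.intervalIntegrable (by fun_prop) _ _)
      (Continuous.intervalIntegrable (by fun_prop) _ _),
    intervalIntegral.integral_const_mul, intervalIntegral.integral_const_mul,
    integral_sum_sum_mul_cos_sub_mul, integral_sum_sum_mul_cos_sub_mul,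
    integral_pi_sub_mul_sum_sum_mul_sin_sub_mul] at hnonneg
  refine le_of_mul_le_mul_left ?_ (mul_pos two_pos hpi)
  linarith

theorem sum_sq_An_mul_le {n : ℕ} (x : Fin n → ℝ) :
    ∑ i, (∑ j, An n i j * x j) ^ 2 ≤ Real.pi ^ 2 * ∑ j, x j ^ 2 := by
  have hpi := Real.pi_pos
  have h := neg_sum_mul_An_le x fun i => -(∑ j, An n i j * x j) / Real.pi
  have hcross : -∑ i, -(∑ j, An n i j * x j) / Real.pi * ∑ j, An n i j * x j =
      (∑ i, (∑ j, An n i j * x j) ^ 2) / Real.pi := by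
    rw [← Finset.sum_neg_distrib, Finset.sum_div]
    exact Finset.sum_congr rfl fun i _ => by ring
  have hsq : ∑ i, (-(∑ j, An n i j * x j) / Real.pi) ^ 2 =
      (∑ i, (∑ j, An n i j * x j) ^ 2) / Real.pi ^ 2 := by
    simp only [div_pow, neg_sq, Finset.sum_div]
  rw [hcross, hsq] at h
  field_simp at h
  linarith

/-- For every positive integer `n`, `‖Aₙ‖_opr ≤ π`. -/
theorem oprNorm_An_le_pi (n : ℕ) (hn : 0 < n) : oprNorm (An n) ≤ Real.pi := by
  refine Real.sSup_le ?_ Real.pi_pos.le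
  rintro _ ⟨x, hx, rfl⟩
  rw [Real.sqrt_le_left Real.pi_pos.le]
  exact (sum_sq_An_mul_le x).trans (mul_le_of_le_one_right (by positivity) hx)
end
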